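/- Let p be an odd prime. Then t_{p-1} ≡ (-1)^{(p-1)/2}·(2p + 2^p - 2 + (p·B_{p-1})²) (mod p²), where (t_n) is the sequence defined below and B_{p-1} is the (p-1)-th Bernoulli number. -/

import Mathlib

/-- The sequence `t_0 = 1`, `t_1 = 5`,
`t_{n+1} = (8n²+12n+5) t_n - 4n²(2n+1)² t_{n-1}` for `n ≥ 1`. -/
def t : ℕ → ℤ
  | 0 => 1
  | 1 => 5
  | (n + 2) => (8 * ((n : ℤ) + 1) ^ 2 + 12 * ((n : ℤ) + 1) + 5) * t (n + 1)
      - 4 * ((n : ℤ) + 1) ^ 2 * (2 * ((n : ℤ) + 1) + 1) ^ 2 * t n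

/-- `a ≡ b (mod p^r)` for rationals: `a - b` is `p^r` times a rational whose
denominator (in lowest terms) is not divisible by `p`. -/
def pcong (p r : ℕ) (a b : ℚ) : Prop :=
  ∃ q : ℚ, a - b = (p : ℚ) ^ r * q ∧ ¬ (p ∣ q.den)

open Finset

theorem t_succ (m : ℕ) :
    t (m + 1) = (2 * (m + 1)) ^ 2 * t m + ∏ j ∈ range (m + 1), (2 * (j : ℤ) + 1) ^ 2 := by
  induction m with
  | zero => simp [t]
  | succ m ih =>
    rw [prod_range_succ, ← sub_eq_iff_eq_add'.mpr ih, t]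
    push_cast
    ring

/-- The deformation of `t` in which each factor `(2j+1)²` is replaced by `(2j+1)² - x²`. -/
def tDeformed (x : ℤ) : ℕ → ℤ
  | 0 => 1
  | m + 1 => (2 * (m + 1)) ^ 2 * tDeformed x m
      + ∏ j ∈ range (m + 1), ((2 * (j : ℤ) + 1) ^ 2 - x ^ 2)

theorem t_modEq_tDeformed (x : ℤ) (m : ℕ) : t m ≡ tDeformed x m [ZMOD x ^ 2] := by
  induction m with
  | zero => rfl
  | succ m ih =>
    rw [t_succ, tDeformed]
    refine (ih.mul_left _).add (Int.ModEq.prod fun j _ => ?_)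
    exact Int.modEq_iff_dvd.mpr ⟨-1, by ring⟩

theorem prod_odd_sq_sub_odd_sq (n k : ℕ) :
    ∏ j ∈ range k, ((2 * (j : ℤ) + 1) ^ 2 - (2 * n + 1) ^ 2)
      = 4 ^ k * (k.factorial : ℤ) ^ 2 * ((-1) ^ k * n.choose k * (n + k).choose n) := by
  induction k with
  | zero => simp
  | succ k ih =>
    have h₁ : (n.choose (k + 1) : ℤ) * (k + 1) = n.choose k * (n - k) := by
      rcases le_or_gt k n with h | h
      · have := Nat.choose_succ_right_eq n k
        zify [h] at this
        exact this
      · simp [Nat.choose_eq_zero_of_lt h, Nat.choose_eq_zero_of_lt (h.trans k.lt_succ_self)]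
    have h₂ : ((n + (k + 1)).choose n : ℤ) * (k + 1) = (n + k).choose n * (n + k + 1) := by
      have := Nat.choose_mul_succ_eq (n + k) n
      rw [show n + k + 1 - n = k + 1 by omega] at this
      zify at this
      rw [← add_assoc, this]
    rw [prod_range_succ, ih, Nat.factorial_succ]
    push_cast
    linear_combination
      4 ^ (k + 1) * (k.factorial : ℤ) ^ 2 * (-1) ^ k *
        ((n + (k + 1)).choose n * (k + 1) * h₁ + n.choose k * (n - k) * h₂)

theorem tDeformed_odd (n m : ℕ) :
    tDeformed (2 * n + 1) m = 4 ^ m * (m.factorial : ℤ) ^ 2 *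
      ∑ k ∈ range (m + 1), (-1) ^ k * (n.choose k : ℤ) * (n + k).choose n := by
  induction m with
  | zero => simp [tDeformed]
  | succ m ih =>
    rw [tDeformed, ih, prod_odd_sq_sub_odd_sq, sum_range_succ _ (m + 1), Nat.factorial_succ]
    push_cast
    ring

theorem sum_neg_one_pow_mul_choose_mul_choose (n : ℕ) :
    ∑ k ∈ range (n + 1), (-1) ^ k * (n.choose k : ℤ) * (n + k).choose n = (-1) ^ n := by
  have h := Polynomial.shiftedLegendre_eval_symm n (1 : ℤ)
  rw [sub_self, Polynomial.aeval_def, Polynomial.aeval_def,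
    Polynomial.eval₂_at_zero, Polynomial.coeff_shiftedLegendre] at h
  simpa [Polynomial.shiftedLegendre, Polynomial.eval₂_finsetSum] using h

theorem tDeformed_odd_two_mul (n : ℕ) :
    tDeformed (2 * n + 1) (2 * n) = 4 ^ (2 * n) * ((2 * n).factorial : ℤ) ^ 2 * (-1) ^ n := by
  rw [tDeformed_odd, ← sum_neg_one_pow_mul_choose_mul_choose n]
  congr 1
  refine (sum_subset (by simp; omega) fun k _ hk => ?_).symm
  rw [Nat.choose_eq_zero_of_lt (by simpa using hk)]
  simp

/-- A product of integers `≡ 1 (mod d)` is linear modulo `d²`. -/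
theorem prod_modEq_one_add_sum {ι : Type*} (s : Finset ι) (a : ι → ℤ) (d : ℤ)
    (h : ∀ i ∈ s, d ∣ a i - 1) :
    ∏ i ∈ s, a i ≡ 1 + ∑ i ∈ s, (a i - 1) [ZMOD d ^ 2] := by
  classical
  induction s using Finset.induction_on with
  | empty => simp
  | insert i s hi ih =>
    rw [prod_insert hi, sum_insert hi]
    obtain ⟨u, hu⟩ : d ∣ ∑ i ∈ s, (a i - 1) := dvd_sum fun j hj => h j (mem_insert_of_mem hj)
    obtain ⟨v, hv⟩ := h i (mem_insert_self i s)
    refine ((ih fun j hj => h j (mem_insert_of_mem hj)).mul_left _).trans ?_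
    rw [hu, eq_add_of_sub_eq hv]
    exact Int.modEq_iff_dvd.mpr ⟨-(u * v), by ring⟩

theorem dvd_factorial_add_one {n : ℕ} (hp : (2 * n + 1).Prime) :
    (2 * n + 1 : ℤ) ∣ (2 * n).factorial + 1 := by
  have : Fact (2 * n + 1).Prime := ⟨hp⟩
  have h := ZMod.wilsons_lemma (2 * n + 1)
  have h' : (((2 * n).factorial + 1 : ℤ) : ZMod (2 * n + 1)) = 0 := by
    rw [Nat.add_sub_cancel] at h
    push_cast
    rw [h]
    ring
  exact_mod_cast (ZMod.intCast_zmod_eq_zero_iff_dvd _ _).mp h'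

theorem sum_pow_pred_modEq_factorial {n : ℕ} (hp : (2 * n + 1).Prime) :
    ∑ k ∈ range (2 * n + 1), (k : ℤ) ^ (2 * n)
      ≡ (2 * n).factorial + (2 * n + 1) [ZMOD (2 * n + 1) ^ 2] := by
  have hn : n ≠ 0 := by rintro rfl; exact Nat.not_prime_one hp
  set F : ℤ := ((2 * n).factorial : ℤ) with hF
  have hfermat : ∀ k ∈ range (2 * n), (2 * n + 1 : ℤ) ∣ ((k + 1 : ℕ) : ℤ) ^ (2 * n) - 1 := by
    intro k hk
    have hcop : IsCoprime ((k + 1 : ℕ) : ℤ) ((2 * n + 1 : ℕ) : ℤ) := by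
      rw [Nat.isCoprime_iff_coprime, Nat.coprime_comm, hp.coprime_iff_not_dvd]
      have := mem_range.mp hk
      exact Nat.not_dvd_of_pos_of_lt k.succ_pos (by omega)
    simpa using (Int.ModEq.pow_card_sub_one_eq_one hp hcop).symm.dvd
  have h₁ := prod_modEq_one_add_sum (range (2 * n)) _ _ hfermat
  have hprod : ∏ k ∈ range (2 * n), ((k + 1 : ℕ) : ℤ) ^ (2 * n) = (F ^ 2) ^ n := by
    rw [prod_pow, ← pow_mul, hF, ← prod_range_add_one_eq_factorial]
    push_cast
    rfl
  obtain ⟨w, hw⟩ : (2 * n + 1 : ℤ) ∣ F + 1 := dvd_factorial_add_one hp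
  have h₂ := prod_modEq_one_add_sum (range n) (fun _ => F ^ 2) (2 * n + 1)
    fun _ _ => ⟨w * (F - 1), by linear_combination (F - 1) * hw⟩
  rw [prod_const, card_range, ← hprod] at h₂
  obtain ⟨c, hc⟩ := (h₁.symm.trans h₂).dvd
  rw [sum_range_succ', Nat.cast_zero, zero_pow (by omega), add_zero]
  simp only [sum_sub_distrib, sum_const, card_range, nsmul_eq_mul] at hc
  push_cast at hc ⊢
  refine Int.modEq_iff_dvd.mpr ⟨c - n * w ^ 2 + w, ?_⟩
  have hF' : F = (2 * n + 1) * w - 1 := by linear_combination hw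
  rw [hF'] at hc ⊢
  linear_combination hc

theorem t_two_mul_modEq {n : ℕ} (hp : (2 * n + 1).Prime) :
    t (2 * n) ≡ (-1) ^ n * (2 * (2 * n + 1) + 2 ^ (2 * n + 1) - 2
      + (∑ k ∈ range (2 * n + 1), (k : ℤ) ^ (2 * n)) ^ 2) [ZMOD (2 * n + 1) ^ 2] := by
  refine (t_modEq_tDeformed (2 * n + 1) (2 * n)).trans ?_
  rw [tDeformed_odd_two_mul, mul_comm (4 ^ _ * _)]
  refine Int.ModEq.mul_left _ ?_
  have h := sum_pow_pred_modEq_factorial hp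
  set F : ℤ := ((2 * n).factorial : ℤ)
  set S : ℤ := ∑ k ∈ range (2 * n + 1), (k : ℤ) ^ (2 * n)
  obtain ⟨w, hw⟩ : (2 * n + 1 : ℤ) ∣ F + 1 := dvd_factorial_add_one hp
  obtain ⟨a, ha⟩ : (2 * n + 1 : ℤ) ∣ 2 ^ (2 * n) - 1 := by
    have hcop : IsCoprime ((2 : ℕ) : ℤ) ((2 * n + 1 : ℕ) : ℤ) := by
      rw [Nat.isCoprime_iff_coprime]
      simp
    simpa using (Int.ModEq.pow_card_sub_one_eq_one hp hcop).symm.dvd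
  obtain ⟨c, hc⟩ := h.dvd
  have h4 : (4 : ℤ) ^ (2 * n) = (2 ^ (2 * n)) ^ 2 := by
    rw [pow_right_comm]; norm_num
  rw [h4, pow_succ (2 : ℤ), eq_add_of_sub_eq ha]
  have hF' : F = (2 * n + 1) * w - 1 := by linear_combination hw
  have hS : S = (2 * n + 1) * w - 1 + (2 * n + 1) - (2 * n + 1) ^ 2 * c := by
    linear_combination hF' - hc
  rw [hF', hS]
  generalize (2 * n + 1 : ℤ) = P
  rw [Int.modEq_iff_dvd]
  refine ⟨2 * w + 1 - 2 * c * (P * w + P - 1) + P ^ 2 * c ^ 2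
    + 2 * a * (2 * w - P * w ^ 2) - a ^ 2 * (P * w - 1) ^ 2, by ring⟩

/-- The rational numbers integral at `p`. -/
abbrev pIntegers (p : ℕ) [Fact p.Prime] : Subring ℚ := (Rat.padicValuation p).integer

theorem mem_pIntegers {p : ℕ} [Fact p.Prime] {x : ℚ} : x ∈ pIntegers p ↔ ¬ p ∣ x.den :=
  Rat.padicValuation_le_one_iff

theorem bernoulli'_mem_pIntegers {p : ℕ} [Fact p.Prime] {n : ℕ} (hn : n + 1 < p) :
    bernoulli' n ∈ pIntegers p := by
  induction n using Nat.strong_induction_on with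
  | _ n ih =>
    rw [bernoulli'_def]
    refine sub_mem (one_mem _) (sum_mem fun k hk => ?_)
    have hk' := mem_range.mp hk
    have hinv : ((n - k + 1 : ℕ) : ℚ)⁻¹ ∈ pIntegers p := by
      rw [mem_pIntegers, Rat.inv_natCast_den_of_pos (by omega)]
      exact Nat.not_dvd_of_pos_of_lt (by omega) (by omega)
    rw [div_eq_mul_inv, ← Nat.cast_sub hk'.le, ← Nat.cast_add_one]
    exact mul_mem (mul_mem (natCast_mem _ _) hinv) (ih k hk' (by omega))

theorem exists_sum_pow_pred_sub_eq {p : ℕ} [Fact p.Prime] (hodd : Odd p) :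
    ∃ q ∈ pIntegers p,
      ∑ k ∈ range p, (k : ℚ) ^ (p - 1) - p * bernoulli (p - 1) = p ^ 2 * q := by
  have hp : p.Prime := Fact.out
  have hp0 : (p : ℚ) ≠ 0 := mod_cast hp.ne_zero
  have hp1 : p - 1 + 1 = p := Nat.sub_add_cancel hp.one_le
  suffices h : ∀ i ∈ range (p - 1), ∃ q ∈ pIntegers p,
      bernoulli i * (p.choose i) * (p : ℚ) ^ (p - i) / p = p ^ 2 * q by
    choose! q hq hq' using h
    refine ⟨∑ i ∈ range (p - 1), q i, sum_mem hq, ?_⟩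
    rw [sum_range_pow, sum_range_succ, ← Nat.cast_add_one, hp1, mul_sum, ← sum_congr rfl hq',
      Nat.sub_sub_self hp.one_le, Nat.choose_symm hp.one_le, Nat.choose_one_right]
    field_simp
    ring
  intro i hi
  have hi' := mem_range.mp hi
  have hB : bernoulli i ∈ pIntegers p :=
    mul_mem (pow_mem (neg_mem (one_mem _)) _) (bernoulli'_mem_pIntegers (by omega))
  rcases Nat.eq_zero_or_pos i with rfl | hi0
  · refine ⟨(p : ℚ) ^ (p - 3), pow_mem (natCast_mem _ _) _, ?_⟩
    have h3 : p - 3 + 3 = p := by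
      obtain ⟨n, rfl⟩ := hodd
      omega
    rw [tsub_zero, div_eq_iff hp0]
    have hpow : (p : ℚ) ^ p = p ^ (p - 3) * p ^ 3 := by rw [← pow_add, h3]
    simp only [bernoulli_zero, Nat.choose_zero_right, Nat.cast_one, hpow]
    ring
  · obtain ⟨c, hc⟩ := hp.dvd_choose_self hi0.ne' (by omega)
    refine ⟨bernoulli i * c * (p : ℚ) ^ (p - i - 2),
      mul_mem (mul_mem hB (natCast_mem _ _)) (pow_mem (natCast_mem _ _) _), ?_⟩
    rw [hc, show p - i = p - i - 2 + 2 by omega, pow_add]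
    push_cast
    field_simp

theorem t_p_sub_one_cong (p : ℕ) (hp : p.Prime) (hodd : Odd p) :
    pcong p 2 ((t (p - 1) : ℚ))
      ((-1 : ℚ) ^ ((p - 1) / 2)
        * (2 * p + 2 ^ p - 2 + ((p : ℚ) * bernoulli (p - 1)) ^ 2)) := by
  have : Fact p.Prime := ⟨hp⟩
  obtain ⟨q, hq, hSq⟩ := exists_sum_pow_pred_sub_eq (p := p) hodd
  obtain ⟨n, rfl⟩ := hodd
  obtain ⟨c, hc⟩ := (t_two_mul_modEq hp).symm.dvd
  qify at hc
  simp only [Nat.add_sub_cancel, Nat.mul_div_cancel_left n two_pos] at hSq ⊢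
  set S : ℚ := ∑ k ∈ range (2 * n + 1), (k : ℚ) ^ (2 * n)
  have hSmem : S ∈ pIntegers (2 * n + 1) := sum_mem fun k _ => pow_mem (natCast_mem _ _) _
  refine ⟨c + (-1) ^ n * (q * (2 * S - ((2 * n + 1 : ℕ) : ℚ) ^ 2 * q)), ?_, mem_pIntegers.mp ?_⟩
  · have hB : ((2 * n + 1 : ℕ) : ℚ) * bernoulli (2 * n) = S - ((2 * n + 1 : ℕ) : ℚ) ^ 2 * q := by
      linear_combination -hSq
    rw [hB]
    push_cast
    linear_combination hc
  · exact add_mem (intCast_mem _ _) (mul_mem (pow_mem (neg_mem (one_mem _)) _)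
      (mul_mem hq (sub_mem (mul_mem (ofNat_mem _ 2) hSmem)
        (mul_mem (pow_mem (natCast_mem _ _) _) hq))))
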